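/- For every x ∈ ℂ and every τ in the complex upper half-plane ℍ (so that also −1/τ and −1/(2τ) lie in ℍ), the following identity holds: 2⁶ · e^{2πi x²/τ} · τ⁴ · Θ(2πi x/τ, −1/τ)² · η(−1/τ)⁸ · Θ(4πi x, 2τ)² · η(2τ)¹⁶ = Θ(2πi x, τ)² · η(τ)⁸ · Θ(2πi x/τ, −1/(2τ))² · η(−1/(2τ))¹⁶. (Equivalently, setting F(x,τ) = Θ(2πix,2τ)²η(2τ)⁸ / (Θ(2πix,τ)²η(τ)¹⁶) and F̃(x,τ) = 2^{−6}·Θ(2πix,τ)²η(τ)⁸ / (Θ(4πix,2τ)²η(2τ)¹⁶), one has e^{2πix²/τ}·τ⁴·F(x/τ, −1/(2τ)) = F̃(x,τ); this is the identity showing that the quasimodular form f_g is the Fricke involute of f̃_g in the paper's evaluation of the Hodge integrals of Enriques surfaces.) -/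

import Mathlib

open Complex

/-- The Dedekind eta function `η(τ) = e^{πiτ/12}·∏_{n≥1}(1−qⁿ)` with `q = e^{2πiτ}`. -/
noncomputable def dedekindEta (τ : ℂ) : ℂ :=
  Complex.exp (Real.pi * Complex.I * τ / 12) *
    ∏' n : ℕ, (1 - Complex.exp (2 * Real.pi * Complex.I * τ) ^ (n + 1))

/-- The normalized Jacobi theta function
`Θ(z,τ) = (e^{z/2} − e^{−z/2})·∏_{m≥1}(1−e^z qᵐ)(1−e^{−z} qᵐ)/(1−qᵐ)²` with `q = e^{2πiτ}`. -/
noncomputable def jacobiThetaN (z τ : ℂ) : ℂ :=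
  (Complex.exp (z / 2) - Complex.exp (-z / 2)) *
    ∏' m : ℕ,
      ((1 - Complex.exp z * Complex.exp (2 * Real.pi * Complex.I * τ) ^ (m + 1)) *
          (1 - Complex.exp (-z) * Complex.exp (2 * Real.pi * Complex.I * τ) ^ (m + 1)) /
        (1 - Complex.exp (2 * Real.pi * Complex.I * τ) ^ (m + 1)) ^ 2)

section QPochhammer

variable {q : ℂ}

/-- The infinite `q`-Pochhammer symbol `(w; q)_∞ = ∏_{m≥0} (1 − w qᵐ)`. -/
noncomputable def qPochhammerInf (q w : ℂ) : ℂ := ∏' m : ℕ, (1 - w * q ^ m)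

lemma summable_norm_neg_mul_pow (hq : ‖q‖ < 1) (w : ℂ) :
    Summable fun m : ℕ ↦ ‖-(w * q ^ m)‖ := by
  simpa using (summable_geometric_of_lt_one (norm_nonneg q) hq).mul_left ‖w‖

lemma multipliable_one_sub_mul_pow (hq : ‖q‖ < 1) (w : ℂ) :
    Multipliable fun m : ℕ ↦ 1 - w * q ^ m := by
  simpa only [sub_eq_add_neg] using
    multipliable_one_add_of_summable (summable_norm_neg_mul_pow hq w)

lemma qPochhammerInf_eq_mul (hq : ‖q‖ < 1) (w : ℂ) :
    qPochhammerInf q w = (1 - w) * qPochhammerInf q (w * q) := by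
  have h : Multipliable fun m : ℕ ↦ 1 - w * q ^ (m + 1) := by
    simpa only [mul_assoc, ← pow_succ'] using multipliable_one_sub_mul_pow hq (w * q)
  simp only [qPochhammerInf, mul_assoc, ← pow_succ']
  rw [tprod_eq_zero_mul' (f := fun m : ℕ ↦ 1 - w * q ^ m) h, pow_zero, mul_one]

lemma exists_mul_pow_eq_one_of_qPochhammerInf_eq_zero (hq : ‖q‖ < 1) {w : ℂ}
    (h : qPochhammerInf q w = 0) : ∃ m : ℕ, w * q ^ m = 1 := by
  by_contra! hne
  refine tprod_one_add_ne_zero_of_summable (f := fun m : ℕ ↦ -(w * q ^ m)) (fun m ↦ ?_)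
    (summable_norm_neg_mul_pow hq w) (by simpa only [qPochhammerInf, sub_eq_add_neg] using h)
  rw [← sub_eq_add_neg, sub_ne_zero]
  exact (hne m).symm

lemma qPochhammerInf_self_ne_zero (hq : ‖q‖ < 1) : qPochhammerInf q q ≠ 0 := by
  intro h
  obtain ⟨m, hm⟩ := exists_mul_pow_eq_one_of_qPochhammerInf_eq_zero hq h
  rw [← pow_succ'] at hm
  have := pow_lt_one₀ (norm_nonneg q) hq m.succ_ne_zero
  rw [← norm_pow, hm, norm_one] at this
  exact lt_irrefl _ this

lemma differentiable_qPochhammerInf (hq : ‖q‖ < 1) : Differentiable ℂ (qPochhammerInf q) := by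
  intro w
  have h : HasProdLocallyUniformlyOn (fun (m : ℕ) w ↦ 1 + -(w * q ^ m))
      (fun w ↦ ∏' m : ℕ, (1 + -(w * q ^ m))) (Metric.ball (0 : ℂ) (‖w‖ + 1)) := by
    refine Summable.hasProdLocallyUniformlyOn_nat_one_add Metric.isOpen_ball
      ((summable_geometric_of_lt_one (norm_nonneg q) hq).mul_left (‖w‖ + 1))
      (.of_forall fun m x hx ↦ ?_) fun m ↦ by fun_prop
    rw [norm_neg, norm_mul, norm_pow]
    gcongr
    exact (mem_ball_zero_iff.mp hx).le
  have hd := h.differentiableOn (.of_forall fun s ↦ by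
    simpa [Finset.prod_fn] using DifferentiableOn.finsetProd (fun _ _ ↦ by fun_prop))
    Metric.isOpen_ball
  have := hd.differentiableAt (Metric.isOpen_ball.mem_nhds (x := w) (by simp))
  simpa only [← sub_eq_add_neg] using! this

end QPochhammer

section DoublyPeriodic

open Function Filter Topology

variable {α : Type*} {τ : ℂ}

lemma Function.Periodic.int_add_int_mul {f : ℂ → α} (h₁ : Periodic f 1) (h₂ : Periodic f τ)
    (n k : ℤ) : Periodic f (n + k * τ) := by
  simpa using (h₁.int_mul n).add_period (h₂.int_mul k)

/-- Liouville's theorem for elliptic functions: an entire doubly periodic function is constant. -/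
lemma Differentiable.apply_eq_apply_of_periodic {f : ℂ → ℂ} (hτ : 0 < τ.im)
    (hf : Differentiable ℂ f) (h₁ : Periodic f 1) (h₂ : Periodic f τ) (z w : ℂ) : f z = f w := by
  refine hf.apply_eq_apply_of_bounded ?_ z w
  let g : ℝ × ℝ → ℂ := fun p ↦ f (p.1 + p.2 * τ)
  have hg : Continuous g := hf.continuous.comp (by fun_prop)
  refine (((isCompact_Icc (a := (0 : ℝ)) (b := 1)).prod
    (isCompact_Icc (a := (0 : ℝ)) (b := 1))).image hg).isBounded.subset ?_
  rintro _ ⟨x, rfl⟩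
  let b : ℝ := x.im / τ.im
  let a : ℝ := x.re - b * τ.re
  refine ⟨(Int.fract a, Int.fract b), ⟨⟨Int.fract_nonneg a, (Int.fract_lt_one a).le⟩,
    ⟨Int.fract_nonneg b, (Int.fract_lt_one b).le⟩⟩, ?_⟩
  have hx : x = a + b * τ := by
    apply Complex.ext
    · simp [a]
    · simp [b, hτ.ne']
  change f (Int.fract a + Int.fract b * τ) = f x
  rw [← h₁.int_add_int_mul h₂ ⌊a⌋ ⌊b⌋, hx]
  congr 1
  have ha : (a : ℂ) = ⌊a⌋ + Int.fract a := mod_cast (Int.floor_add_fract a).symm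
  have hb : (b : ℂ) = ⌊b⌋ + Int.fract b := mod_cast (Int.floor_add_fract b).symm
  linear_combination -ha - τ * hb

/-- Two entire functions with the same nonvanishing factors of automorphy under `1` and `τ`, both
vanishing at `0`, are proportional if the second has only simple zeros, on the lattice. -/
lemma mul_eq_mul_of_quasiPeriodic {f h a b : ℂ → ℂ} {c d : ℂ} (hτ : 0 < τ.im)
    (hf : Differentiable ℂ f) (hh : Differentiable ℂ h) (ha : ∀ x, a x ≠ 0) (hb : ∀ x, b x ≠ 0)
    (hf₁ : ∀ x, f (x + 1) = a x * f x) (hh₁ : ∀ x, h (x + 1) = a x * h x)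
    (hf₂ : ∀ x, f (x + τ) = b x * f x) (hh₂ : ∀ x, h (x + τ) = b x * h x)
    (hf₀ : f 0 = 0) (hh₀ : h 0 = 0) (hfc : HasDerivAt f c 0) (hhd : HasDerivAt h d 0)
    (hd : d ≠ 0) (hz : ∀ x, h x = 0 → ∃ n k : ℤ, x = n + k * τ) (x : ℂ) :
    d * f x = c * h x := by
  classical
  let Q : ℂ → ℂ := fun x ↦ if h x = 0 then c / d else f x / h x
  have hQ₁ : Periodic Q 1 := fun x ↦ by
    simp only [Q, hh₁, hf₁, mul_eq_zero, ha, false_or, mul_div_mul_left _ _ (ha x)]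
  have hQ₂ : Periodic Q τ := fun x ↦ by
    simp only [Q, hh₂, hf₂, mul_eq_zero, hb, false_or, mul_div_mul_left _ _ (hb x)]
  have dslope_diff {g : ℂ → ℂ} (hg : Differentiable ℂ g) : Differentiable ℂ (dslope g 0) :=
    differentiableOn_univ.mp
      ((Complex.differentiableOn_dslope univ_mem).mpr hg.differentiableOn)
  have eq_mul {g : ℂ → ℂ} (hg : g 0 = 0) (y : ℂ) : g y = y * dslope g 0 y := by
    simpa [hg] using (sub_smul_dslope g 0 y).symm
  have hd₀ : dslope h 0 0 = d := by rw [dslope_same, hhd.deriv]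
  have hc₀ : dslope f 0 0 = c := by rw [dslope_same, hfc.deriv]
  have hQ₀ : DifferentiableAt ℂ Q 0 := by
    refine ((dslope_diff hf 0).div (dslope_diff hh 0) (hd₀ ▸ hd)).congr_of_eventuallyEq ?_
    filter_upwards [(dslope_diff hh).continuous.continuousAt.eventually_ne (hd₀ ▸ hd)] with y hy
    rcases eq_or_ne y 0 with rfl | hy₀
    · simp [Q, hh₀, hfc.deriv, hhd.deriv]
    · simp only [Q, Pi.div_apply]
      rw [eq_mul hh₀ y, eq_mul hf₀ y, if_neg (mul_ne_zero hy₀ hy), mul_div_mul_left _ _ hy₀]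
  have hQ : Differentiable ℂ Q := fun x ↦ by
    by_cases hx : h x = 0
    · obtain ⟨n, k, hnk⟩ := hz x hx
      have hp : (fun y ↦ Q (y - x)) = Q := by
        ext y
        rw [hnk]
        exact (hQ₁.int_add_int_mul hQ₂ n k).sub_eq y
      rw [← hp]
      have hQx : DifferentiableAt ℂ Q (x - x) := by rwa [sub_self]
      exact hQx.comp (f := fun y ↦ y - x) x (by fun_prop)
    · refine ((hf x).div (hh x) hx).congr_of_eventuallyEq ?_
      filter_upwards [hh.continuous.continuousAt.eventually_ne hx] with y hy
      simp [Q, hy]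
  have hconst : Q x = c / d := by
    rw [hQ.apply_eq_apply_of_periodic hτ hQ₁ hQ₂ x 0]
    simp [Q, hh₀]
  by_cases hx : h x = 0
  · obtain ⟨n, k, rfl⟩ := hz x hx
    have hp₁ : Periodic (fun y ↦ f y = 0) 1 := fun y ↦ by simp [hf₁, ha]
    have hp₂ : Periodic (fun y ↦ f y = 0) τ := fun y ↦ by simp [hf₂, hb]
    have := hp₁.int_add_int_mul hp₂ n k 0
    simp only [zero_add, hf₀, eq_iff_iff, iff_true] at this
    rw [this, hx, mul_zero, mul_zero]
  · simp only [Q, if_neg hx] at hconst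
    rw [div_eq_div_iff hx hd] at hconst
    linear_combination hconst

end DoublyPeriodic

section JacobiTheta

variable {τ : ℂ}

lemma norm_exp_two_pi_I_mul_lt_one (hτ : 0 < τ.im) :
    ‖Complex.exp (2 * Real.pi * Complex.I * τ)‖ < 1 :=
  UpperHalfPlane.norm_exp_two_pi_I_lt_one ⟨τ, hτ⟩

lemma jacobiThetaN_eq_sub_mul (hτ : 0 < τ.im) (z : ℂ) :
    jacobiThetaN z τ = (Complex.exp (z / 2) - Complex.exp (-z / 2)) *
      (qPochhammerInf (Complex.exp (2 * Real.pi * Complex.I * τ))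
          (Complex.exp z * Complex.exp (2 * Real.pi * Complex.I * τ)) *
        qPochhammerInf (Complex.exp (2 * Real.pi * Complex.I * τ))
          (Complex.exp (-z) * Complex.exp (2 * Real.pi * Complex.I * τ)) /
        qPochhammerInf (Complex.exp (2 * Real.pi * Complex.I * τ))
          (Complex.exp (2 * Real.pi * Complex.I * τ)) ^ 2) := by
  have hq := norm_exp_two_pi_I_mul_lt_one hτ
  have hne := qPochhammerInf_self_ne_zero hq
  unfold jacobiThetaN
  generalize Complex.exp (2 * Real.pi * Complex.I * τ) = q at *
  have hp (w : ℂ) : HasProd (fun m : ℕ ↦ 1 - w * q * q ^ m) (qPochhammerInf q (w * q)) :=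
    (multipliable_one_sub_mul_pow hq (w * q)).hasProd
  have h₁ : HasProd (fun m : ℕ ↦ 1 - q * q ^ m) (qPochhammerInf q q) :=
    (multipliable_one_sub_mul_pow hq q).hasProd
  rw [sq (qPochhammerInf q q),
    ← (((hp _).mul (hp _)).div₀ (h₁.mul h₁) (mul_ne_zero hne hne)).tprod_eq]
  congr 1
  exact tprod_congr fun m ↦ by ring

lemma jacobiThetaN_eq_mul (hτ : 0 < τ.im) (z : ℂ) :
    jacobiThetaN z τ = Complex.exp (z / 2) *
      qPochhammerInf (Complex.exp (2 * Real.pi * Complex.I * τ)) (Complex.exp (-z)) *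
      qPochhammerInf (Complex.exp (2 * Real.pi * Complex.I * τ))
        (Complex.exp z * Complex.exp (2 * Real.pi * Complex.I * τ)) /
      qPochhammerInf (Complex.exp (2 * Real.pi * Complex.I * τ))
        (Complex.exp (2 * Real.pi * Complex.I * τ)) ^ 2 := by
  rw [jacobiThetaN_eq_sub_mul hτ,
    qPochhammerInf_eq_mul (norm_exp_two_pi_I_mul_lt_one hτ) (Complex.exp (-z))]
  have : Complex.exp (-z / 2) = Complex.exp (z / 2) * Complex.exp (-z) := by
    rw [← Complex.exp_add]; ring_nf
  rw [this]
  ring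

lemma jacobiThetaN_zero (τ : ℂ) : jacobiThetaN 0 τ = 0 := by simp [jacobiThetaN]

lemma differentiable_jacobiThetaN (hτ : 0 < τ.im) :
    Differentiable ℂ fun z ↦ jacobiThetaN z τ := by
  have hE := differentiable_qPochhammerInf (norm_exp_two_pi_I_mul_lt_one hτ)
  simp_rw [jacobiThetaN_eq_sub_mul hτ]
  fun_prop

lemma hasDerivAt_jacobiThetaN_zero (hτ : 0 < τ.im) :
    HasDerivAt (fun z ↦ jacobiThetaN z τ) 1 0 := by
  have hq := norm_exp_two_pi_I_mul_lt_one hτ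
  have hE := differentiable_qPochhammerInf hq
  have hne := qPochhammerInf_self_ne_zero hq
  simp_rw [jacobiThetaN_eq_sub_mul hτ]
  generalize Complex.exp (2 * Real.pi * Complex.I * τ) = q at *
  have h₁ : HasDerivAt (fun z : ℂ ↦ Complex.exp (z / 2) - Complex.exp (-z / 2)) 1 0 := by
    have h := ((hasDerivAt_id (0 : ℂ)).div_const 2).cexp.sub
      ((hasDerivAt_id (0 : ℂ)).neg.div_const 2).cexp
    convert! h using 1
    norm_num
  have h₂ : DifferentiableAt ℂ (fun z : ℂ ↦ qPochhammerInf q (Complex.exp z * q) *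
      qPochhammerInf q (Complex.exp (-z) * q) / qPochhammerInf q q ^ 2) 0 := by fun_prop
  convert! h₁.mul h₂.hasDerivAt using 1
  simp [← sq, hne]

lemma jacobiThetaN_add_two_pi_I (z τ : ℂ) :
    jacobiThetaN (z + 2 * Real.pi * Complex.I) τ = -jacobiThetaN z τ := by
  have h₁ : Complex.exp ((z + 2 * Real.pi * Complex.I) / 2) = -Complex.exp (z / 2) := by
    rw [show (z + 2 * Real.pi * Complex.I) / 2 = z / 2 + Real.pi * Complex.I by ring,
      Complex.exp_add, Complex.exp_pi_mul_I, mul_neg_one]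
  have h₂ : Complex.exp (-(z + 2 * Real.pi * Complex.I) / 2) = -Complex.exp (-z / 2) := by
    rw [show -(z + 2 * Real.pi * Complex.I) / 2 = -z / 2 - Real.pi * Complex.I by ring,
      Complex.exp_sub, Complex.exp_pi_mul_I, div_neg, div_one]
  have h₃ : Complex.exp (-(z + 2 * Real.pi * Complex.I)) = Complex.exp (-z) := by
    rw [neg_add', Complex.exp_periodic.sub_eq]
  unfold jacobiThetaN
  rw [h₁, h₂, h₃, Complex.exp_periodic z]
  ring

lemma jacobiThetaN_add_two_pi_I_mul (hτ : 0 < τ.im) (z : ℂ) :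
    jacobiThetaN (z + 2 * Real.pi * Complex.I * τ) τ =
      -Complex.exp (-z - Real.pi * Complex.I * τ) * jacobiThetaN z τ := by
  have hq := norm_exp_two_pi_I_mul_lt_one hτ
  rw [jacobiThetaN_eq_mul hτ, jacobiThetaN_eq_mul hτ]
  set t := 2 * Real.pi * Complex.I * τ with ht
  set q := Complex.exp t
  rw [qPochhammerInf_eq_mul hq (Complex.exp (-(z + t))),
    qPochhammerInf_eq_mul hq (Complex.exp z * q)]
  have h₁ : Complex.exp (-(z + t)) * q = Complex.exp (-z) := by
    rw [← Complex.exp_add]; ring_nf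
  have h₂ : Complex.exp (z + t) = Complex.exp z * q := Complex.exp_add _ _
  have h₃ : Complex.exp ((z + t) / 2) * (1 - Complex.exp (-(z + t))) =
      -Complex.exp (-z - Real.pi * Complex.I * τ) * Complex.exp (z / 2) *
        (1 - Complex.exp z * q) := by
    rw [show Real.pi * Complex.I * τ = t / 2 by rw [ht]; ring]
    simp only [mul_sub, mul_one, neg_mul, q, ← Complex.exp_add]
    ring_nf
  rw [h₁, h₂]
  linear_combination qPochhammerInf q (Complex.exp (-z)) *
    qPochhammerInf q (Complex.exp z * q * q) / qPochhammerInf q q ^ 2 * h₃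

lemma exists_eq_add_mul_of_jacobiThetaN_eq_zero (hτ : 0 < τ.im) {x : ℂ}
    (h : jacobiThetaN (2 * Real.pi * Complex.I * x) τ = 0) : ∃ n k : ℤ, x = n + k * τ := by
  have hq := norm_exp_two_pi_I_mul_lt_one hτ
  rw [jacobiThetaN_eq_mul hτ, div_eq_zero_iff,
    or_iff_left (pow_ne_zero 2 (qPochhammerInf_self_ne_zero hq)), mul_eq_zero, mul_eq_zero,
    or_iff_right (Complex.exp_ne_zero _)] at h
  rcases h with h | h
  · obtain ⟨m, hm⟩ := exists_mul_pow_eq_one_of_qPochhammerInf_eq_zero hq h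
    rw [← Complex.exp_nat_mul, ← Complex.exp_add, Complex.exp_eq_one_iff] at hm
    obtain ⟨n, hn⟩ := hm
    refine ⟨-n, m, mul_left_cancel₀ Complex.two_pi_I_ne_zero ?_⟩
    push_cast
    linear_combination -hn
  · obtain ⟨m, hm⟩ := exists_mul_pow_eq_one_of_qPochhammerInf_eq_zero hq h
    rw [← Complex.exp_nat_mul, ← Complex.exp_add, ← Complex.exp_add, Complex.exp_eq_one_iff] at hm
    obtain ⟨n, hn⟩ := hm
    refine ⟨n, -(m + 1), mul_left_cancel₀ Complex.two_pi_I_ne_zero ?_⟩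
    push_cast
    linear_combination hn

lemma im_neg_one_div_pos (hτ : 0 < τ.im) : 0 < (-1 / τ).im := by
  have h := UpperHalfPlane.im_inv_neg_coe_pos ⟨τ, hτ⟩
  rwa [show -1 / τ = (-τ)⁻¹ by rw [neg_div, one_div, inv_neg]]

/-- The Jacobi inversion formula `Θ(2πix/τ, −1/τ) = e^{πix²/τ} Θ(2πix, τ) / τ`. -/
lemma jacobiThetaN_neg_one_div (hτ : 0 < τ.im) (x : ℂ) :
    jacobiThetaN (2 * Real.pi * Complex.I * x / τ) (-1 / τ) =
      Complex.exp (Real.pi * Complex.I * x ^ 2 / τ) *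
        jacobiThetaN (2 * Real.pi * Complex.I * x) τ / τ := by
  have hτ₀ : τ ≠ 0 := by rintro rfl; simp at hτ
  have hσ := im_neg_one_div_pos hτ
  have hΘ := differentiable_jacobiThetaN hτ
  have hΘ' := differentiable_jacobiThetaN hσ
  let e : ℂ → ℂ := fun x ↦ Complex.exp (-(Real.pi * Complex.I * x ^ 2 / τ))
  let f : ℂ → ℂ := fun x ↦ e x * jacobiThetaN (2 * Real.pi * Complex.I * x / τ) (-1 / τ)
  let h : ℂ → ℂ := fun x ↦ jacobiThetaN (2 * Real.pi * Complex.I * x) τ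
  have he : Differentiable ℂ e := by fun_prop
  have hlin (c : ℂ) : HasDerivAt (fun x : ℂ ↦ c * x) c 0 := by
    simpa using (hasDerivAt_id (0 : ℂ)).const_mul c
  have hh' : HasDerivAt h (2 * Real.pi * Complex.I) 0 := by
    have h0 : HasDerivAt (fun z ↦ jacobiThetaN z τ) 1 (2 * Real.pi * Complex.I * 0) := by
      simpa using hasDerivAt_jacobiThetaN_zero hτ
    simpa using! h0.comp 0 (hlin (2 * Real.pi * Complex.I))
  have hf' : HasDerivAt f (2 * Real.pi * Complex.I / τ) 0 := by
    have h0 : HasDerivAt (fun z ↦ jacobiThetaN z (-1 / τ)) 1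
        (2 * Real.pi * Complex.I / τ * 0) := by
      simpa using hasDerivAt_jacobiThetaN_zero hσ
    have h1 := (he 0).hasDerivAt.mul (h0.comp 0 (hlin (2 * Real.pi * Complex.I / τ)))
    convert! h1 using 1
    · ext y
      simp [f, div_mul_eq_mul_div]
    · simp [e, jacobiThetaN_zero]
  have key := mul_eq_mul_of_quasiPeriodic (f := f) (h := h) (a := fun _ ↦ -1)
    (b := fun x ↦ -Complex.exp (-(2 * Real.pi * Complex.I * x) - Real.pi * Complex.I * τ))
    hτ (by fun_prop) (by fun_prop) (by simp) (by simp) ?_ ?_ ?_ ?_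
    (by simp [f, jacobiThetaN_zero]) (by simp [h, jacobiThetaN_zero]) hf' hh'
    Complex.two_pi_I_ne_zero (fun x ↦ exists_eq_add_mul_of_jacobiThetaN_eq_zero hτ) x
  · have hcancel : 2 * Real.pi * Complex.I * f x =
        2 * Real.pi * Complex.I * (h x / τ) := by rw [key]; ring
    have hfx := mul_left_cancel₀ Complex.two_pi_I_ne_zero hcancel
    change _ = Complex.exp (Real.pi * Complex.I * x ^ 2 / τ) * h x / τ
    rw [mul_div_assoc _ (h x), ← hfx, ← mul_assoc, ← Complex.exp_add, add_neg_cancel,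
      Complex.exp_zero, one_mul]
  · intro x
    have hs := jacobiThetaN_add_two_pi_I_mul hσ (2 * Real.pi * Complex.I * (x + 1) / τ)
    rw [show 2 * Real.pi * Complex.I * (x + 1) / τ + 2 * Real.pi * Complex.I * (-1 / τ) =
      2 * Real.pi * Complex.I * x / τ by ring] at hs
    simp only [f, e]
    rw [hs, neg_one_mul, neg_mul, mul_neg, neg_neg, ← mul_assoc, ← Complex.exp_add]
    congr 2
    ring
  · intro x
    simp only [h]
    rw [mul_add, mul_one, jacobiThetaN_add_two_pi_I, neg_one_mul]
  · intro x
    simp only [f, e]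
    rw [show 2 * Real.pi * Complex.I * (x + τ) / τ =
      2 * Real.pi * Complex.I * x / τ + 2 * Real.pi * Complex.I by field_simp,
      jacobiThetaN_add_two_pi_I, mul_neg, neg_mul, ← mul_assoc, ← Complex.exp_add]
    congr 3
    field_simp
    ring
  · intro x
    simp only [h]
    rw [mul_add, jacobiThetaN_add_two_pi_I_mul hτ]

end JacobiTheta

section DedekindEta

lemma dedekindEta_eq_eta (τ : ℂ) : dedekindEta τ = ModularForm.eta τ := by
  simp only [dedekindEta, ModularForm.eta, ModularForm.eta_q_eq_pow, Function.Periodic.qParam]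
  congr 2
  push_cast
  ring

lemma dedekindEta_neg_one_div_pow_eight {τ : ℂ} (hτ : 0 < τ.im) :
    dedekindEta (-1 / τ) ^ 8 = τ ^ 4 * dedekindEta τ ^ 8 := by
  have hτ₀ : τ ≠ 0 := by rintro rfl; simp at hτ
  have sqrt_pow_eight {z : ℂ} (hz : z ≠ 0) : Complex.sqrt z ^ 8 = z ^ 4 := by
    rw [sqrt_eq_exp hz, ← Complex.exp_nat_mul,
      show ((8 : ℕ) : ℂ) * (Complex.log z / 2) = (4 : ℕ) * Complex.log z by push_cast; ring,
      Complex.exp_nat_mul, Complex.exp_log hz]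
  have h : ModularForm.eta (-1 / τ) =
      (Complex.sqrt Complex.I)⁻¹ * (Complex.sqrt τ * ModularForm.eta τ) := by
    simpa using ModularForm.eta_comp_eq_csqrt_I_inv hτ
  rw [dedekindEta_eq_eta, dedekindEta_eq_eta, h, mul_pow, mul_pow, inv_pow,
    sqrt_pow_eight Complex.I_ne_zero, sqrt_pow_eight hτ₀, Complex.I_pow_four, inv_one, one_mul]

end DedekindEta

/-- The Fricke-involution identity
`2⁶·e^{2πix²/τ}·τ⁴·Θ(2πix/τ,−1/τ)²·η(−1/τ)⁸·Θ(4πix,2τ)²·η(2τ)¹⁶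
  = Θ(2πix,τ)²·η(τ)⁸·Θ(2πix/τ,−1/(2τ))²·η(−1/(2τ))¹⁶`. -/
theorem fricke_involute_identity (x τ : ℂ) (hτ : 0 < τ.im) :
    2 ^ 6 * Complex.exp (2 * Real.pi * Complex.I * x ^ 2 / τ) * τ ^ 4 *
        jacobiThetaN (2 * Real.pi * Complex.I * x / τ) (-1 / τ) ^ 2 *
        dedekindEta (-1 / τ) ^ 8 *
        jacobiThetaN (4 * Real.pi * Complex.I * x) (2 * τ) ^ 2 *
        dedekindEta (2 * τ) ^ 16 =
      jacobiThetaN (2 * Real.pi * Complex.I * x) τ ^ 2 * dedekindEta τ ^ 8 *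
        jacobiThetaN (2 * Real.pi * Complex.I * x / τ) (-1 / (2 * τ)) ^ 2 *
        dedekindEta (-1 / (2 * τ)) ^ 16 := by
  have hτ₀ : τ ≠ 0 := by rintro rfl; simp at hτ
  have h2τ : 0 < (2 * τ).im := by simpa using hτ
  have hη := dedekindEta_neg_one_div_pow_eight hτ
  have hη₂ : dedekindEta (-1 / (2 * τ)) ^ 16 = ((2 * τ) ^ 4 * dedekindEta (2 * τ) ^ 8) ^ 2 := by
    rw [← dedekindEta_neg_one_div_pow_eight h2τ, ← pow_mul]
  have hΘ₂ := jacobiThetaN_neg_one_div h2τ (2 * x)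
  rw [show 2 * Real.pi * Complex.I * (2 * x) / (2 * τ) = 2 * Real.pi * Complex.I * x / τ by
      field_simp,
    show 2 * Real.pi * Complex.I * (2 * x) = 4 * Real.pi * Complex.I * x by ring,
    show Real.pi * Complex.I * (2 * x) ^ 2 / (2 * τ) =
      (2 : ℕ) * (Real.pi * Complex.I * x ^ 2 / τ) by push_cast; field_simp,
    Complex.exp_nat_mul] at hΘ₂
  rw [hη, hη₂, jacobiThetaN_neg_one_div hτ x, hΘ₂,
    show 2 * Real.pi * Complex.I * x ^ 2 / τ =
      (2 : ℕ) * (Real.pi * Complex.I * x ^ 2 / τ) by push_cast; ring, Complex.exp_nat_mul]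
  field_simp
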